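/- arXiv:2311.17289 — 2 statements merged into one kernel-verified Lean document; each statement's English description precedes it below -/
import Mathlib

section
/- Let x, p : I → ℝⁿ be differentiable curves satisfying the coordinate Hamiltonian system of a sub-Riemannian normal geodesic. Then x is twice differentiable on I and its second derivative satisfies, for every t ∈ I and every index i, ẍⁱ(t) = Σ_{j,k,l} ( 2 Γⁱʲ_k(x(t)) gᵏˡ(x(t)) − gⁱᵏ(x(t)) Γˡʲ_k(x(t)) ) p_l(t) p_j(t). -/
open Filter Topology

/-- Chain rule along a curve, in coordinates. -/
theorem hasDerivAt_comp_pi_single {n : ℕ} {f : (Fin n → ℝ) → ℝ} {x : ℝ → Fin n → ℝ}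
    {v : Fin n → ℝ} {t : ℝ} (hf : DifferentiableAt ℝ f (x t))
    (hx : ∀ k, HasDerivAt (fun s => x s k) (v k) t) :
    HasDerivAt (fun s => f (x s)) (∑ k, fderiv ℝ f (x t) (Pi.single k 1) * v k) t := by
  have h := hf.hasFDerivAt.comp_hasDerivAt t (hasDerivAt_pi.2 hx)
  refine h.congr_deriv ?_
  conv_lhs => rw [pi_eq_sum_univ' v, map_sum]
  refine Finset.sum_congr rfl fun k _ => ?_
  rw [map_smul, smul_eq_mul, mul_comm]

/-- If `(x, p)` solves the coordinate Hamiltonian system of a sub-Riemannian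
normal geodesic, then `x` is twice differentiable on the interval and the second derivative
is given by the stated formula. -/
theorem stmt0 (n : ℕ) (hn : 1 ≤ n)
    (g : (Fin n → ℝ) → Matrix (Fin n) (Fin n) ℝ)
    (hg : ∀ i j, ContDiff ℝ 1 (fun y => g y i j))
    (hgsymm : ∀ y, (g y).IsSymm)
    (Γ : (Fin n → ℝ) → Fin n → Fin n → Fin n → ℝ)
    (hΓ : ∀ y i j k, Γ y i j k = (1 / 2) * fderiv ℝ (fun z => g z i j) y (Pi.single k 1))
    (a b : ℝ) (ha : a < 0) (hb : 0 < b)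
    (x p : ℝ → Fin n → ℝ)
    (hx : ∀ t ∈ Set.Ioo a b, ∀ i,
      HasDerivAt (fun s => x s i) (∑ j, g (x t) i j * p t j) t)
    (hp : ∀ t ∈ Set.Ioo a b, ∀ i,
      HasDerivAt (fun s => p s i) (-∑ j, ∑ k, Γ (x t) j k i * p t j * p t k) t) :
    ∀ t ∈ Set.Ioo a b, ∀ i,
      HasDerivAt (fun s => deriv (fun r => x r i) s)
        (∑ j, ∑ k, ∑ l,
          (2 * Γ (x t) i j k * g (x t) k l - g (x t) i k * Γ (x t) l j k) * p t l * p t j) t := by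
  intro t ht i
  have hderiv : (fun s => deriv (fun r => x r i) s) =ᶠ[𝓝 t] fun s => ∑ j, g (x s) i j * p s j := by
    filter_upwards [isOpen_Ioo.mem_nhds ht] with s hs using (hx s hs i).deriv
  refine HasDerivAt.congr_of_eventuallyEq ?_ hderiv
  have hsum := HasDerivAt.fun_sum (u := Finset.univ) fun j _ =>
    (hasDerivAt_comp_pi_single ((hg i j).differentiable one_ne_zero (x t)) (hx t ht)).mul
      (hp t ht j)
  refine hsum.congr_deriv ?_
  have hfderiv : ∀ j k, fderiv ℝ (fun z => g z i j) (x t) (Pi.single k 1) = 2 * Γ (x t) i j k := by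
    intro j k
    rw [hΓ]
    ring
  simp only [hfderiv, sub_mul, Finset.sum_add_distrib, Finset.sum_sub_distrib, mul_neg,
    Finset.sum_neg_distrib, Finset.mul_sum, Finset.sum_mul]
  rw [sub_eq_add_neg]
  congr 1
  · refine Finset.sum_congr rfl fun j _ => Finset.sum_congr rfl fun k _ =>
      Finset.sum_congr rfl fun l _ => ?_
    ring
  · congr 1
    conv_rhs => rw [Finset.sum_comm]
    refine Finset.sum_congr rfl fun k _ => ?_
    rw [Finset.sum_comm]
    refine Finset.sum_congr rfl fun j _ => Finset.sum_congr rfl fun l _ => ?_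
    ring
end

section
/- Let x, p : I → ℝⁿ be differentiable curves satisfying the coordinate Hamiltonian system of a sub-Riemannian normal geodesic. Define the curve x̃ : ℝ → ℝⁿ by x̃ⁱ(t) := xⁱ(0) + t Σ_j gⁱʲ(x(0)) p_j(0) + (1/2) t² Σ_{j,k,l} ( 2 gˡᵏ(x(0)) Γⁱʲ_k(x(0)) − gⁱᵏ(x(0)) Γˡʲ_k(x(0)) ) p_l(0) p_j(0). Then x̃ approximates x to second order at t = 0, i.e. ‖x(t) − x̃(t)‖ / t² → 0 as t → 0. -/
open Filter Topology

/-- Second-order Taylor expansion with Peano remainder for a function that is differentiable near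
`0` and whose derivative is differentiable at `0`. -/
theorem tendsto_taylor_two_remainder {f f' : ℝ → ℝ} {c : ℝ}
    (hf : ∀ᶠ t in 𝓝 (0 : ℝ), HasDerivAt f (f' t) t) (hf' : HasDerivAt f' c 0) :
    Tendsto (fun t => (f t - (f 0 + t * f' 0 + (1 / 2) * t ^ 2 * c)) / t ^ 2)
      (𝓝[≠] (0 : ℝ)) (𝓝 0) := by
  have hderiv : ∀ᶠ t in 𝓝 (0 : ℝ), HasDerivAt
      (fun s => f s - (f 0 + s * f' 0 + (1 / 2) * s ^ 2 * c)) (f' t - (f' 0 + t * c)) t := by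
    filter_upwards [hf] with t ht
    have h1 := ((hasDerivAt_id t).mul_const (f' 0)).const_add (f 0)
    have h2 := (((hasDerivAt_id t).pow 2).const_mul (1 / 2 : ℝ)).mul_const c
    refine (ht.sub (h1.add h2)).congr_deriv ?_
    simp
  refine HasDerivAt.lhopital_zero_nhdsNE (f' := fun t => f' t - (f' 0 + t * c))
    (g' := fun t => 2 * t) (hderiv.filter_mono nhdsWithin_le_nhds) ?_ ?_ ?_ ?_ ?_
  · refine Eventually.of_forall fun t => ?_
    simpa using hasDerivAt_pow 2 t
  · filter_upwards [self_mem_nhdsWithin] with t ht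
    exact mul_ne_zero two_ne_zero ht
  · have h := hderiv.self_of_nhds.continuousAt.tendsto
    simp only [zero_mul, add_zero, ne_eq, OfNat.ofNat_ne_zero, not_false_eq_true, zero_pow,
      mul_zero, sub_self] at h
    exact h.mono_left nhdsWithin_le_nhds
  · have h : Tendsto (fun t : ℝ => t ^ 2) (𝓝 0) (𝓝 (0 ^ 2)) := (continuous_pow 2).tendsto 0
    rw [zero_pow two_ne_zero] at h
    exact h.mono_left nhdsWithin_le_nhds
  · have h := ((hasDerivAt_iff_tendsto_slope.1 hf').sub_const c).div_const 2
    rw [sub_self, zero_div] at h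
    refine h.congr' ?_
    filter_upwards [self_mem_nhdsWithin] with t ht
    have ht' : t ≠ 0 := ht
    rw [slope_def_field]
    field_simp
    ring

/-- The explicit quadratic Taylor curve `xApprox` built from the Hamiltonian data at
`t = 0` approximates the normal geodesic `x` to second order at `t = 0`. -/
theorem stmt1 (n : ℕ) (hn : 1 ≤ n)
    (g : (Fin n → ℝ) → Matrix (Fin n) (Fin n) ℝ)
    (hg : ∀ i j, ContDiff ℝ 1 (fun y => g y i j))
    (hgsymm : ∀ y, (g y).IsSymm)
    (Γ : (Fin n → ℝ) → Fin n → Fin n → Fin n → ℝ)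
    (hΓ : ∀ y i j k, Γ y i j k = (1 / 2) * fderiv ℝ (fun z => g z i j) y (Pi.single k 1))
    (a b : ℝ) (ha : a < 0) (hb : 0 < b)
    (x p : ℝ → Fin n → ℝ)
    (hx : ∀ t ∈ Set.Ioo a b, ∀ i,
      HasDerivAt (fun s => x s i) (∑ j, g (x t) i j * p t j) t)
    (hp : ∀ t ∈ Set.Ioo a b, ∀ i,
      HasDerivAt (fun s => p s i) (-∑ j, ∑ k, Γ (x t) j k i * p t j * p t k) t)
    (xApprox : ℝ → Fin n → ℝ)
    (hxApprox : ∀ t i, xApprox t i =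
      x 0 i + t * ∑ j, g (x 0) i j * p 0 j
        + (1 / 2) * t ^ 2 * ∑ j, ∑ k, ∑ l,
            (2 * g (x 0) l k * Γ (x 0) i j k - g (x 0) i k * Γ (x 0) l j k) * p 0 l * p 0 j) :
    Tendsto (fun t => ‖x t - xApprox t‖ / t ^ 2) (𝓝[≠] (0 : ℝ)) (𝓝 0) := by
  have hnear : ∀ᶠ t in 𝓝 (0 : ℝ), t ∈ Set.Ioo a b := Ioo_mem_nhds ha hb
  have h0 : (0 : ℝ) ∈ Set.Ioo a b := ⟨ha, hb⟩
  have hxderiv : HasDerivAt x (fun k => ∑ l, g (x 0) k l * p 0 l) 0 :=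
    hasDerivAt_pi.2 fun i => hx 0 h0 i
  have hgderiv : ∀ i j, HasDerivAt (fun t => g (x t) i j)
      (∑ k, (∑ l, g (x 0) k l * p 0 l) * (2 * Γ (x 0) i j k)) 0 := by
    intro i j
    have hd : HasFDerivAt (fun y => g y i j) (fderiv ℝ (fun y => g y i j) (x 0)) (x 0) :=
      ((hg i j).differentiable one_ne_zero (x 0)).hasFDerivAt
    refine (hd.comp_hasDerivAt (0 : ℝ) hxderiv).congr_deriv ?_
    rw [← ContinuousLinearMap.coe_coe, LinearMap.pi_apply_eq_sum_univ]
    refine Finset.sum_congr rfl fun k _ => ?_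
    have hk : (fun m => if k = m then (1 : ℝ) else 0) = Pi.single k 1 := by
      ext m
      simp [Pi.single_apply, eq_comm]
    rw [hk, hΓ, smul_eq_mul, ContinuousLinearMap.coe_coe]
    ring
  have hvel : ∀ i, HasDerivAt (fun t => ∑ j, g (x t) i j * p t j)
      (∑ j, ∑ k, ∑ l,
        (2 * g (x 0) l k * Γ (x 0) i j k - g (x 0) i k * Γ (x 0) l j k) * p 0 l * p 0 j) 0 := by
    intro i
    refine (HasDerivAt.fun_sum fun j _ => (hgderiv i j).mul (hp 0 h0 j)).congr_deriv ?_
    simp only [sub_mul, Finset.sum_sub_distrib, mul_neg, ← sub_eq_add_neg]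
    congr 1
    · refine Finset.sum_congr rfl fun j _ => ?_
      rw [Finset.sum_mul]
      refine Finset.sum_congr rfl fun k _ => ?_
      simp only [Finset.sum_mul]
      refine Finset.sum_congr rfl fun l _ => ?_
      rw [(hgsymm (x 0)).apply l k]
      ring
    · simp only [Finset.mul_sum]
      rw [Finset.sum_congr rfl fun k _ => Finset.sum_comm, Finset.sum_comm]
      refine Finset.sum_congr rfl fun j _ => Finset.sum_congr rfl fun k _ =>
        Finset.sum_congr rfl fun l _ => ?_
      ring
  have hlim : Tendsto (fun t => (t ^ 2)⁻¹ • (x t - xApprox t)) (𝓝[≠] (0 : ℝ)) (𝓝 0) := by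
    refine tendsto_pi_nhds.2 fun i => ?_
    refine (tendsto_taylor_two_remainder (hnear.mono fun t ht => hx t ht i) (hvel i)).congr
      fun t => ?_
    rw [Pi.smul_apply, Pi.sub_apply, hxApprox, smul_eq_mul, div_eq_inv_mul]
  refine (tendsto_zero_iff_norm_tendsto_zero.1 hlim).congr fun t => ?_
  rw [norm_smul, norm_inv, norm_pow, Real.norm_eq_abs, sq_abs, div_eq_inv_mul]
end
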